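/- [Rendezvous guarantee of Phase 3 of Algorithm RVO] Let c > 0, p ≥ 1 and let w : ℤ → ℝ model a cycle with p vertices and circumference c as in the context. Let l and L be distinct positive integers and let s₁, s₂ ∈ ℤ. Let f₁ be any walk of the RVO phase-3 route for label l starting at vertex index s₁, and let f₂ be any walk of the RVO phase-3 route for label L starting at vertex index s₂. Then f₁ and f₂ meet, i.e., there exists t ∈ [0,1] with f₁(t) − f₂(t) ∈ cℤ. (This asserts that two asynchronous agents with distinct labels executing Phase 3 of Algorithm RVO on a common cycle are guaranteed to meet, regardless of the adversarially chosen walks of their routes.) -/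

import Mathlib

/- A cycle with `p ≥ 1` vertices and circumference `c > 0` is modeled via its universal
cover: a strictly increasing `w : ℤ → ℝ` with `w (i + p) = w i + c`; the value `w i` is the
lift of the `i`-th vertex, and two reals represent the same point of the cycle iff their
difference lies in `cℤ`. -/

/-- A walk of the route `q 0, q 1, …, q N`: a continuous `f : [0,1] → ℝ` together with
times `0 = t 0 ≤ t 1 ≤ … ≤ t N = 1` such that `f (t j) = w (q j)` and, on `[t j, t (j+1)]`,
`f` stays in the closed interval with endpoints `w (q j)` and `w (q (j+1))`. -/
def IsWalk (w : ℤ → ℝ) (N : ℕ) (q : ℕ → ℤ) (f : ℝ → ℝ) : Prop :=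
  ContinuousOn f (Set.Icc 0 1) ∧
  ∃ t : ℕ → ℝ, t 0 = 0 ∧ t N = 1 ∧ (∀ j, j < N → t j ≤ t (j + 1)) ∧
    (∀ j, j ≤ N → f (t j) = w (q j)) ∧
    (∀ j, j < N → ∀ s ∈ Set.Icc (t j) (t (j + 1)),
      f s ∈ Set.uIcc (w (q j)) (w (q (j + 1))))

/-- The modified label `μ*` of a positive integer `μ`: its binary representation (most
significant bit first), followed by a single `1`, followed by `|μ|` zeros, where
`|μ| = ⌊log₂ μ⌋ + 1` is the length of the binary representation of `μ`.
(For `μ > 0`, `Nat.bits μ` is the binary representation of `μ`, least significant bit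
first, of length `|μ|`.) -/
def modifiedLabel (μ : ℕ) : List Bool :=
  (Nat.bits μ).reverse ++ [true] ++ List.replicate (Nat.bits μ).length false

/-- Direction of the `j`-th tour (0-indexed) of the RVO phase-3 route for label `μ`:
stage `i` (0-indexed) consists of tours `2*i` and `2*i + 1`, both in direction `+1` if the
`(i+1)`-st bit of `μ*` is `1`, and `-1` otherwise. -/
def rvoDir (μ : ℕ) (j : ℕ) : ℤ :=
  if (modifiedLabel μ).getD (j / 2) false then 1 else -1

/-- The RVO phase-3 route for label `μ` starting at vertex index `s`, on a cycle with `p`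
vertices: the concatenation, for each of the `2|μ| + 1` bits of `μ*`, of two tours in
direction `+1` if the bit is `1` and `-1` otherwise, each tour starting at the vertex
index where the previous one ended. The `m`-th vertex index of this route. -/
def rvoRoute (p : ℕ) (s : ℤ) (μ : ℕ) (m : ℕ) : ℤ :=
  s + (∑ j ∈ Finset.range (m / p), rvoDir μ j) * p + rvoDir μ (m / p) * (m % p)

/-- Normalised abstract agent: tour checkpoints `T j` with integer positions `A j`. -/
structure RvoAgent (F : ℝ → ℝ) (n : ℕ) (A : ℕ → ℤ) (T : ℕ → ℝ) : Prop where
  mono : Monotone T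
  mem : ∀ j, T j ∈ Set.Icc (0 : ℝ) 1
  val : ∀ j, j ≤ 2 * n → F (T j) = A j
  cell : ∀ τ ∈ Set.Icc (0 : ℝ) 1, ∃ i, i ≤ n ∧ (i = 0 ∨ T (2 * i - 1) ≤ τ) ∧
    τ ≤ T (2 * i + 1) ∧ |F τ - A (2 * i)| ≤ 1
  par : ∀ j, A j % 2 = (j : ℤ) % 2
  step : ∀ i, A (2 * (i + 1)) ≠ A (2 * i)

lemma rvo_match {F₁ F₂ : ℝ → ℝ} {n₁ n₂ : ℕ} {A₁ A₂ : ℕ → ℤ} {T₁ T₂ : ℕ → ℝ}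
    (G₁ : RvoAgent F₁ n₁ A₁ T₁) (G₂ : RvoAgent F₂ n₂ A₂ T₂)
    (h : ∀ τ ∈ Set.Icc (0 : ℝ) 1, |F₁ τ - F₂ τ| < 1) :
    ∃ φ : ℕ → ℕ, (∀ i, i ≤ n₁ → φ i ≤ n₂ ∧ A₂ (2 * φ i) = A₁ (2 * i)) ∧
      ∀ i, i < n₁ → φ i < φ (i + 1) := by
  choose φ h1 h2 h3 h4 using fun i => G₂.cell (T₁ (2 * i)) (G₁.mem _)
  have key : ∀ i, i ≤ n₁ → A₂ (2 * φ i) = A₁ (2 * i) := by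
    intro i hi
    have a := h _ (G₁.mem (2 * i))
    rw [G₁.val _ (by omega)] at a
    have b := h4 i
    rw [abs_lt] at a
    rw [abs_le] at b
    have c1 : (A₂ (2 * φ i) : ℝ) < A₁ (2 * i) + 2 := by linarith
    have c2 : (A₁ (2 * i) : ℝ) < A₂ (2 * φ i) + 2 := by linarith
    have d1 : A₂ (2 * φ i) < A₁ (2 * i) + 2 := by exact_mod_cast c1
    have d2 : A₁ (2 * i) < A₂ (2 * φ i) + 2 := by exact_mod_cast c2
    have e1 := G₁.par (2 * i)
    have e2 := G₂.par (2 * φ i)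
    push_cast at e1 e2
    omega
  refine ⟨φ, fun i hi => ⟨h1 i, key i hi⟩, fun i hi => ?_⟩
  by_contra hcon
  rcases Nat.lt_or_ge (φ (i + 1)) (φ i) with hlt | hge
  · have a1 : T₂ (2 * φ i - 1) ≤ T₁ (2 * i) := by
      rcases h2 i with h0 | h0
      · omega
      · exact h0
    have a2 := h3 (i + 1)
    have a3 : T₂ (2 * φ (i + 1) + 1) ≤ T₂ (2 * φ i - 1) := G₂.mono (by omega)
    have a4 : T₁ (2 * i) ≤ T₁ (2 * (i + 1)) := G₁.mono (by omega)
    have a5 : T₁ (2 * i) = T₂ (2 * φ (i + 1) + 1) := by linarith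
    have a6 := h _ (G₁.mem (2 * i))
    rw [G₁.val _ (by omega), a5, G₂.val _ (by have := h1 i; omega), abs_lt] at a6
    have e1 := G₁.par (2 * i)
    have e2 := G₂.par (2 * φ (i + 1) + 1)
    have d1 : -1 < A₁ (2 * i) - A₂ (2 * φ (i + 1) + 1) := by exact_mod_cast a6.1
    have d2 : A₁ (2 * i) - A₂ (2 * φ (i + 1) + 1) < 1 := by exact_mod_cast a6.2
    push_cast at e1 e2
    omega
  · have e : φ (i + 1) = φ i := by omega
    have k1 := key i (by omega)
    have k2 := key (i + 1) (by omega)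
    rw [e, k1] at k2
    exact G₁.step i k2.symm

lemma rvo_grow {φ : ℕ → ℕ} {n : ℕ} (h : ∀ i, i < n → φ i < φ (i + 1)) (i k : ℕ)
    (hk : i + k ≤ n) : φ i + k ≤ φ (i + k) := by
  induction k with
  | zero => simp
  | succ k ih =>
    have a := ih (by omega)
    have b := h (i + k) (by omega)
    rw [← add_assoc i k 1]
    omega

lemma rvo_agents_eq {F₁ F₂ : ℝ → ℝ} {n₁ n₂ : ℕ} {A₁ A₂ : ℕ → ℤ} {T₁ T₂ : ℕ → ℝ}
    (G₁ : RvoAgent F₁ n₁ A₁ T₁) (G₂ : RvoAgent F₂ n₂ A₂ T₂)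
    (h : ∀ τ ∈ Set.Icc (0 : ℝ) 1, |F₁ τ - F₂ τ| < 1) :
    n₁ = n₂ ∧ ∀ i, i ≤ n₁ → A₁ (2 * i) = A₂ (2 * i) := by
  obtain ⟨φ, h1, h2⟩ := rvo_match G₁ G₂ h
  obtain ⟨ψ, h3, h4⟩ := rvo_match G₂ G₁ (fun τ hτ => by rw [abs_sub_comm]; exact h τ hτ)
  have a := rvo_grow h2 0 n₁ (by omega)
  have b := rvo_grow h4 0 n₂ (by omega)
  have a' := (h1 n₁ le_rfl).1
  have b' := (h3 n₂ le_rfl).1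
  simp only [zero_add] at a b
  have hn : n₁ = n₂ := by omega
  refine ⟨hn, fun i hi => ?_⟩
  have c1 := rvo_grow h2 0 i (by omega)
  have c2 := rvo_grow h2 i (n₁ - i) (by omega)
  rw [Nat.add_sub_cancel' hi] at c2
  simp only [zero_add] at c1
  have e : φ i = i := by omega
  have := (h1 i hi).2
  rw [e] at this
  exact this.symm

lemma rvoDir_eq (μ j : ℕ) : rvoDir μ j = 1 ∨ rvoDir μ j = -1 := by
  unfold rvoDir
  split_ifs <;> simp

/-- Partial sums of the tour directions. -/
def rvoSum (μ j : ℕ) : ℤ := ∑ k ∈ Finset.range j, rvoDir μ k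

lemma rvoSum_succ (μ j : ℕ) : rvoSum μ (j + 1) = rvoSum μ j + rvoDir μ j :=
  Finset.sum_range_succ _ _

lemma rvoSum_par (μ j : ℕ) : rvoSum μ j % 2 = (j : ℤ) % 2 := by
  induction j with
  | zero => simp [rvoSum]
  | succ j ih =>
    rw [rvoSum_succ]
    push_cast
    rcases rvoDir_eq μ j with h | h <;> rw [h] <;> omega

lemma rvoDir_odd (μ i : ℕ) : rvoDir μ (2 * i + 1) = rvoDir μ (2 * i) := by
  unfold rvoDir
  rw [show (2 * i + 1) / 2 = 2 * i / 2 by omega]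

lemma rvoSum_step (μ i : ℕ) :
    rvoSum μ (2 * (i + 1)) = rvoSum μ (2 * i) + 2 * rvoDir μ (2 * i) := by
  rw [show 2 * (i + 1) = 2 * i + 1 + 1 by ring, rvoSum_succ, rvoSum_succ, rvoDir_odd]
  ring

lemma rvoRoute_mul (p : ℕ) (hp : 1 ≤ p) (s : ℤ) (μ j : ℕ) :
    rvoRoute p s μ (j * p) = s + rvoSum μ j * p := by
  unfold rvoRoute rvoSum
  rw [Nat.mul_div_cancel _ (by omega)]
  have : ((j * p : ℕ) : ℤ) % (p : ℤ) = 0 := by push_cast; simp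
  rw [this]
  simp

lemma rvoRoute_eq (p : ℕ) (hp : 1 ≤ p) (s : ℤ) (μ j r : ℕ) (hr : r ≤ p) :
    rvoRoute p s μ (j * p + r) = s + rvoSum μ j * p + rvoDir μ j * r := by
  rcases Nat.lt_or_ge r p with h | h
  · have h1 : (j * p + r) / p = j := by
      rw [mul_comm, Nat.mul_add_div (by omega), Nat.div_eq_of_lt h]; simp
    have h2 : ((j * p + r : ℕ) : ℤ) % (p : ℤ) = r := by
      rw [← Int.natCast_mod, mul_comm, Nat.mul_add_mod, Nat.mod_eq_of_lt h]
    unfold rvoRoute rvoSum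
    rw [h1, h2]
  · have e : r = p := by omega
    subst e
    rw [show j * r + r = (j + 1) * r by ring, rvoRoute_mul _ hp, rvoSum_succ]
    ring

lemma rvoRoute_step (p : ℕ) (hp : 1 ≤ p) (s : ℤ) (μ m : ℕ) :
    |rvoRoute p s μ (m + 1) - rvoRoute p s μ m| ≤ 1 := by
  have hm : m = m / p * p + m % p := by rw [mul_comm]; exact (Nat.div_add_mod m p).symm
  have hlt : m % p < p := Nat.mod_lt _ (by omega)
  generalize m / p = j at *
  generalize m % p = r at *
  subst hm
  rw [add_assoc, rvoRoute_eq p hp s μ j r (by omega), rvoRoute_eq p hp s μ j (r + 1) (by omega)]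
  push_cast
  rcases rvoDir_eq μ j with h | h <;> rw [h] <;> rw [abs_le] <;> constructor <;> linarith

lemma rvoRoute_lip (p : ℕ) (hp : 1 ≤ p) (s : ℤ) (μ m k : ℕ) :
    |rvoRoute p s μ (m + k) - rvoRoute p s μ m| ≤ k := by
  induction k with
  | zero => simp
  | succ k ih =>
    have := rvoRoute_step p hp s μ (m + k)
    rw [abs_le] at *
    rw [← add_assoc]
    push_cast
    constructor <;> linarith [this.1, this.2, ih.1, ih.2]

lemma rvo_w_mul {c : ℝ} {p : ℕ} {w : ℤ → ℝ} (hwp : ∀ i : ℤ, w (i + p) = w i + c)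
    (i a : ℤ) : w (i + a * p) = w i + a * c := by
  induction a using Int.induction_on with
  | zero => simp
  | succ k ih =>
    rw [show i + ((k : ℤ) + 1) * p = (i + k * p) + p by ring, hwp, ih]
    push_cast; ring
  | pred k ih =>
    have := hwp (i + (-(k : ℤ) - 1) * p)
    rw [show i + (-(k : ℤ) - 1) * p + p = i + (-(k : ℤ)) * p by ring, ih] at this
    push_cast at this ⊢
    linarith

lemma rvo_find (t : ℕ → ℝ) (τ : ℝ) (h0 : t 0 ≤ τ) (N : ℕ) (hN : 0 < N) (h1 : τ ≤ t N) :
    ∃ m, m < N ∧ t m ≤ τ ∧ τ ≤ t (m + 1) := by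
  induction N with
  | zero => omega
  | succ N ih =>
    by_cases h : t N ≤ τ
    · exact ⟨N, by omega, h, h1⟩
    · push Not at h
      rcases Nat.eq_zero_or_pos N with e | e
      · subst e; linarith
      · obtain ⟨m, hm, hh⟩ := ih e h.le
        exact ⟨m, by omega, hh⟩

lemma rvo_agent_of_walk (c : ℝ) (hc : 0 < c) (p : ℕ) (hp : 1 ≤ p)
    (w : ℤ → ℝ) (hw : StrictMono w) (hwp : ∀ i : ℤ, w (i + p) = w i + c)
    (μ n : ℕ) (hn : 0 < n) (s : ℤ) (f : ℝ → ℝ)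
    (hf : IsWalk w (2 * n * p) (rvoRoute p s μ) f) :
    ∃ T, RvoAgent (fun τ => (f τ - w s) / c) n (rvoSum μ) T := by
  obtain ⟨-, t, ht0, ht1, hmono, hval, hcell⟩ := hf
  have hm : Monotone (fun j => t (min j (2 * n * p))) := by
    apply monotone_nat_of_le_succ
    intro j
    rcases Nat.lt_or_ge j (2 * n * p) with h | h
    · have := hmono j h
      simpa [min_eq_left h.le, min_eq_left (Nat.succ_le_of_lt h)] using this
    · simp [min_eq_right h, min_eq_right (h.trans (Nat.le_succ j))]
  have hpos : 0 < 2 * n * p := by positivity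
  refine ⟨fun j => t (min (j * p) (2 * n * p)), ?_, ?_, ?_, ?_, rvoSum_par μ, ?_⟩
  · intro a b hab
    exact hm (Nat.mul_le_mul_right p hab)
  · intro j
    constructor
    · have := hm (Nat.zero_le (j * p))
      simpa [ht0] using this
    · have := hm (le_max_left (j * p) (2 * n * p))
      simpa [ht1] using this
  · intro j hj
    have hle : j * p ≤ 2 * n * p := Nat.mul_le_mul_right p hj
    simp only [min_eq_left hle]
    rw [hval _ hle, rvoRoute_mul p hp, rvo_w_mul hwp]
    field_simp
    ring
  · intro τ hτ
    obtain ⟨m, hmN, hm1, hm2⟩ := rvo_find t τ (by rw [ht0]; exact hτ.1) _ hpos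
      (by rw [ht1]; exact hτ.2)
    have hj : m / p < 2 * n := Nat.div_lt_of_lt_mul (by rw [mul_comm]; exact hmN)
    have hj1 : m / p * p ≤ m := Nat.div_mul_le_self m p
    have hj2 : m + 1 ≤ (m / p + 1) * p := by
      have := Nat.lt_div_mul_add (a := m) (b := p) (by omega)
      nlinarith
    generalize m / p = j at *
    obtain ⟨i, hi⟩ : ∃ i, i = (j + 1) / 2 := ⟨_, rfl⟩
    have b2 : m + 1 ≤ (2 * i + 1) * p :=
      hj2.trans (Nat.mul_le_mul_right p (by omega))
    have b1 : (2 * i - 1) * p ≤ m :=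
      (Nat.mul_le_mul_right p (by omega)).trans hj1
    have b3 : 2 * i * p ≤ m + p := by
      rcases Nat.eq_zero_or_pos i with e | e
      · subst e; simp
      · have : (2 * i - 1 + 1) * p = 2 * i * p := by congr 1; omega
        rw [← this]; linarith
    have hq : ∀ k, m ≤ k → k ≤ m + 1 → w s + (rvoSum μ (2 * i) - 1) * c ≤ w (rvoRoute p s μ k) ∧
        w (rvoRoute p s μ k) ≤ w s + (rvoSum μ (2 * i) + 1) * c := by
      intro k hk1 hk2
      have hd : |rvoRoute p s μ k - rvoRoute p s μ (2 * i * p)| ≤ p := by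
        rcases le_total k (2 * i * p) with hle | hle
        · obtain ⟨d, hd⟩ := Nat.exists_eq_add_of_le hle
          have := rvoRoute_lip p hp s μ k d
          rw [← hd, abs_sub_comm] at this
          refine this.trans ?_
          have : d ≤ p := by omega
          exact_mod_cast this
        · obtain ⟨d, hd⟩ := Nat.exists_eq_add_of_le hle
          have := rvoRoute_lip p hp s μ (2 * i * p) d
          rw [← hd] at this
          refine this.trans ?_
          have : d ≤ p := by
            have : (2 * i + 1) * p = 2 * i * p + p := by ring
            omega
          exact_mod_cast this
      rw [rvoRoute_mul p hp, abs_le] at hd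
      have w1 := rvo_w_mul hwp s (rvoSum μ (2 * i) - 1)
      have w2 := rvo_w_mul hwp s (rvoSum μ (2 * i) + 1)
      push_cast at w1 w2
      rw [← w1, ← w2]
      constructor <;> apply hw.monotone <;> linarith [hd.1, hd.2]
    refine ⟨i, by omega, ?_, ?_, ?_⟩
    · right
      have := hm b1
      simp only [min_eq_left hmN.le] at this
      exact this.trans hm1
    · have := hm b2
      simp only [min_eq_left (Nat.succ_le_of_lt hmN)] at this
      exact hm2.trans this
    · have hu := hcell m hmN τ ⟨hm1, hm2⟩
      have q1 := hq m le_rfl (by omega)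
      have q2 := hq (m + 1) (by omega) le_rfl
      have hs := Set.uIcc_subset_Icc (Set.mem_Icc.2 q1) (Set.mem_Icc.2 q2) hu
      rw [abs_le]
      constructor
      · rw [le_sub_iff_add_le, le_div_iff₀ hc]
        linarith [hs.1]
      · rw [sub_le_iff_le_add, div_le_iff₀ hc]
        linarith [hs.2]
  · intro i
    rw [rvoSum_step]
    rcases rvoDir_eq μ (2 * i) with h | h <;> rw [h] <;> omega

lemma rvo_gap (c : ℝ) (hc : 0 < c) (g : ℝ → ℝ) (hg : ContinuousOn g (Set.Icc 0 1))
    (h : ∀ t ∈ Set.Icc (0 : ℝ) 1, ∀ m : ℤ, g t ≠ m * c) :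
    ∀ t ∈ Set.Icc (0 : ℝ) 1, |g t - g 0| < c := by
  intro t ht
  have h0 : (0 : ℝ) ∈ Set.Icc (0 : ℝ) 1 := by simp
  have hiv : ∀ x ∈ Set.uIcc (g 0) (g t), ∃ u ∈ Set.Icc (0 : ℝ) 1, g u = x := by
    intro x hx
    have hsub : Set.uIcc 0 t ⊆ Set.Icc (0 : ℝ) 1 := Set.uIcc_subset_Icc h0 ht
    obtain ⟨u, hu, hux⟩ := intermediate_value_uIcc (hg.mono hsub) hx
    exact ⟨u, hsub hu, hux⟩
  by_contra hcon
  push Not at hcon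
  rcases le_abs.1 hcon with h1 | h1
  · have a := Int.le_ceil (g 0 / c)
    have b := Int.ceil_lt_add_one (g 0 / c)
    rw [div_le_iff₀ hc] at a
    rw [← sub_lt_iff_lt_add, lt_div_iff₀ hc] at b
    obtain ⟨u, hu, hux⟩ := hiv (⌈g 0 / c⌉ * c) (Set.mem_uIcc.2 (Or.inl ⟨a, by linarith⟩))
    exact h u hu _ hux
  · have a := Int.floor_le (g 0 / c)
    have b := Int.lt_floor_add_one (g 0 / c)
    rw [le_div_iff₀ hc] at a
    rw [div_lt_iff₀ hc] at b
    obtain ⟨u, hu, hux⟩ := hiv (⌊g 0 / c⌋ * c) (Set.mem_uIcc.2 (Or.inr ⟨by linarith, a⟩))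
    exact h u hu _ hux

lemma rvoDir_label {l L i : ℕ} (h : rvoDir l (2 * i) = rvoDir L (2 * i)) :
    (modifiedLabel l).getD i false = (modifiedLabel L).getD i false := by
  unfold rvoDir at h
  rw [show 2 * i / 2 = i by omega] at h
  revert h
  cases (modifiedLabel l).getD i false <;> cases (modifiedLabel L).getD i false <;> simp

lemma modifiedLabel_length (μ : ℕ) :
    (modifiedLabel μ).length = 2 * (Nat.bits μ).length + 1 := by
  simp [modifiedLabel]; omega

lemma modifiedLabel_inj {l L : ℕ} (h : modifiedLabel l = modifiedLabel L) : l = L := by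
  have hlen : (Nat.bits l).length = (Nat.bits L).length := by
    have := congrArg List.length h
    rw [modifiedLabel_length, modifiedLabel_length] at this
    omega
  unfold modifiedLabel at h
  rw [hlen] at h
  have h1 := List.append_cancel_right (List.append_cancel_right h)
  have h2 := List.reverse_injective h1
  have inj : ∀ a b : ℕ, Nat.bits a = Nat.bits b → a = b := by
    intro a b hab
    apply Nat.eq_of_testBit_eq
    intro i
    rw [Nat.testBit_eq_inth, Nat.testBit_eq_inth, hab]
  exact inj _ _ h2

/-- **Rendezvous guarantee of Phase 3 of Algorithm RVO.** On a common cycle with `p ≥ 1`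
vertices and circumference `c > 0`, two asynchronous agents with distinct positive labels
`l ≠ L`, starting at arbitrary vertex indices `s₁` and `s₂` and executing Phase 3 of
Algorithm RVO (each route being the concatenation of `2|μ| + 1` stages of two tours whose
direction is given by the corresponding bit of `μ*`), meet regardless of the adversarially
chosen walks of their routes: `f₁ t - f₂ t ∈ cℤ` for some `t ∈ [0,1]`. -/
theorem rvo_phase3_rendezvous
    (c : ℝ) (hc : 0 < c) (p : ℕ) (hp : 1 ≤ p)
    (w : ℤ → ℝ) (hw : StrictMono w) (hwp : ∀ i : ℤ, w (i + p) = w i + c)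
    (l L : ℕ) (hl : 0 < l) (hL : 0 < L) (hlL : l ≠ L)
    (s₁ s₂ : ℤ) (f₁ f₂ : ℝ → ℝ)
    (hf₁ : IsWalk w (2 * (modifiedLabel l).length * p) (rvoRoute p s₁ l) f₁)
    (hf₂ : IsWalk w (2 * (modifiedLabel L).length * p) (rvoRoute p s₂ L) f₂) :
    ∃ t ∈ Set.Icc (0 : ℝ) 1, ∃ m : ℤ, f₁ t - f₂ t = m * c := by
  by_contra hcon
  push Not at hcon
  obtain ⟨T₁, G₁⟩ := rvo_agent_of_walk c hc p hp w hw hwp l _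
    (by rw [modifiedLabel_length]; omega) s₁ f₁ hf₁
  obtain ⟨T₂, G₂⟩ := rvo_agent_of_walk c hc p hp w hw hwp L _
    (by rw [modifiedLabel_length]; omega) s₂ f₂ hf₂
  have hgap := rvo_gap c hc (fun t => f₁ t - f₂ t) (hf₁.1.sub hf₂.1) hcon
  have start : ∀ (μ N : ℕ) (s : ℤ) (f : ℝ → ℝ), IsWalk w N (rvoRoute p s μ) f → f 0 = w s := by
    rintro μ N s f ⟨-, t, ht0, -, -, hv, -⟩
    have := hv 0 (by omega)
    rw [ht0] at this
    rw [this]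
    have h0 := rvoRoute_mul p hp s μ 0
    simp [rvoSum] at h0
    rw [h0]
  have e1 := start _ _ _ _ hf₁
  have e2 := start _ _ _ _ hf₂
  obtain ⟨hlen, hsum⟩ := rvo_agents_eq G₁ G₂ (by
    intro τ hτ
    have := hgap τ hτ
    simp only [e1, e2] at this
    rw [← sub_div, abs_div, abs_of_pos hc, div_lt_one hc]
    rw [show f₁ τ - w s₁ - (f₂ τ - w s₂) = f₁ τ - f₂ τ - (w s₁ - w s₂) by ring]
    exact this)
  apply hlL
  apply modifiedLabel_inj
  apply List.ext_getElem hlen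
  intro i hi1 hi2
  have a := hsum i (by omega)
  have b := hsum (i + 1) (by omega)
  rw [rvoSum_step, rvoSum_step, a] at b
  have d := rvoDir_label (l := l) (L := L) (i := i) (by omega)
  rwa [List.getD_eq_getElem _ _ hi1, List.getD_eq_getElem _ _ hi2] at d
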